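/- There do not exist permutations σ₁, σ₂, σ₃ of Fin 8 such that P_{σ₁} + P_{σ₁²} + P_{σ₁³} + P_{σ₂} + P_{σ₂²} + P_{σ₃} + P_{σ₃²} = J − I. That is, for n = 8 and d = 3 reconfigurations of degree-1 topologies, no strategy can realize the all-to-all traffic matrix using hop counts 1,2,3 on the first topology and hop counts 1,2 on each of the other two, so the d = 3 lower bound is not attainable. -/

import Mathlib

/-- The permutation matrix of `σ`: `(P_σ)_{u,v} = 1` if `v = σ u` and `0` otherwise. -/
def permMatrix {n : ℕ} (σ : Equiv.Perm (Fin n)) : Matrix (Fin n) (Fin n) ℕ :=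
  Matrix.of fun u v => if v = σ u then 1 else 0

/-- The all-to-all traffic matrix `J − I`: off-diagonal entries `1`, diagonal `0`. -/
def allToAll (n : ℕ) : Matrix (Fin n) (Fin n) ℕ :=
  Matrix.of fun u v => if u = v then 0 else 1

/-- The row condition: in each row the diagonal cell and the seven reached cells are distinct. -/
def RowsOk (s t r : Equiv.Perm (Fin 8)) : Prop :=
  ∀ u, [u, s u, s (s u), s (s (s u)), t u, t (t u), r u, r (r u)].Nodup

theorem rowsOk_of_eq (s t r : Equiv.Perm (Fin 8))
    (h : permMatrix s + permMatrix (s ^ 2) + permMatrix (s ^ 3) +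
        permMatrix t + permMatrix (t ^ 2) +
        permMatrix r + permMatrix (r ^ 2) = allToAll 8) : RowsOk s t r := by
  intro u
  have key : ∀ v, [u, s u, s (s u), s (s (s u)), t u, t (t u), r u, r (r u)].count v = 1 := by
    intro v
    have hv := congrFun (congrFun h u) v
    simp only [permMatrix, allToAll, Matrix.add_apply, Matrix.of_apply, pow_succ, pow_zero,
      one_mul, Equiv.Perm.mul_apply] at hv
    simp only [List.count_cons, List.count_nil, beq_iff_eq, eq_comm (b := v)]
    have h1 : (if u = v then 0 else 1) + (if v = u then 1 else 0) = 1 := by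
      by_cases huv : u = v
      · simp [huv]
      · simp [huv, Ne.symm huv]
    rw [← hv] at h1
    omega
  rw [List.nodup_iff_count_le_one]
  exact fun v => (key v).le

theorem rowsOk_conj (g s t r : Equiv.Perm (Fin 8)) (h : RowsOk s t r) :
    RowsOk (g * s * g⁻¹) (g * t * g⁻¹) (g * r * g⁻¹) := by
  intro u
  have := (h (g⁻¹ u)).map g.injective
  simpa [Equiv.Perm.mul_apply] using this

theorem pow_fix_of_mem_cycleType (s : Equiv.Perm (Fin 8)) (n : ℕ) (h : n ∈ s.cycleType) :
    ∃ x, (s ^ n) x = x := by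
  obtain ⟨c, τ, rfl, hd, hc, hn⟩ := Equiv.Perm.mem_cycleType_iff.1 h
  obtain ⟨x, hx, -⟩ := id hc
  refine ⟨x, ?_⟩
  have hτ : τ x = x := (hd x).resolve_left hx
  rw [hd.commute.mul_pow, Equiv.Perm.mul_apply, Equiv.Perm.pow_apply_eq_self_of_apply_eq_self hτ,
    ← hn, ← hc.orderOf, pow_orderOf_eq_one]
  rfl

theorem cycleType_cases (s : Equiv.Perm (Fin 8))
    (h : ∀ u, s u ≠ u ∧ s (s u) ≠ u ∧ s (s (s u)) ≠ u) :
    s.cycleType = {8} ∨ s.cycleType = {4, 4} := by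
  have h4 : ∀ n ∈ s.cycleType, 4 ≤ n := by
    intro n hn
    have h2 := Equiv.Perm.two_le_of_mem_cycleType hn
    obtain ⟨x, hx⟩ := pow_fix_of_mem_cycleType s n hn
    by_contra hlt
    obtain rfl | rfl : n = 2 ∨ n = 3 := by omega
    · exact (h x).2.1 (by simpa [pow_succ] using hx)
    · exact (h x).2.2 (by simpa [pow_succ] using hx)
  have hsum : s.cycleType.sum = 8 := by
    rw [Equiv.Perm.sum_cycleType]
    have : s.support = Finset.univ := by
      ext x; simpa using (h x).1
    rw [this]; rfl
  generalize s.cycleType = m at *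
  have hcard := Multiset.card_nsmul_le_sum h4
  rw [hsum] at hcard
  have h3 : m.card = 0 ∨ m.card = 1 ∨ m.card = 2 := by
    simp only [smul_eq_mul] at hcard; omega
  rcases h3 with h0 | h1 | h2
  · rw [Multiset.card_eq_zero] at h0
    simp [h0] at hsum
  · obtain ⟨a, rfl⟩ := Multiset.card_eq_one.1 h1
    left; simp at hsum; rw [hsum]
  · obtain ⟨a, b, rfl⟩ := Multiset.card_eq_two.1 h2
    right
    have ha := h4 a (by simp)
    have hb := h4 b (by simp)
    simp at hsum
    obtain ⟨rfl, rfl⟩ : a = 4 ∧ b = 4 := by omega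
    rfl

theorem cycleType_rot : (finRotate 8).cycleType = {8} := cycleType_finRotate (n := 6)

theorem cycleType_rot_sq : (finRotate 8 ^ 2).cycleType = {4, 4} := by
  refine (cycleType_cases _ (by decide +kernel)).resolve_left fun h => ?_
  have h1 := Equiv.Perm.lcm_cycleType (finRotate 8 ^ 2)
  rw [h] at h1
  have h2 : (finRotate 8 ^ 2) ^ 4 = 1 := by decide +kernel
  have h3 := orderOf_dvd_of_pow_eq_one h2
  rw [← h1] at h3
  revert h3; simp

/-- With two 4-cycles (`u ↦ u + 2`), parity already rules out the second topology. -/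
theorem even_case (t r : Equiv.Perm (Fin 8)) (h : RowsOk (finRotate 8 ^ 2) t r) : False := by
  have key : ∀ u, (t u).val % 2 ≠ u.val % 2 ∧ (t (t u)).val % 2 ≠ u.val % 2 := by
    intro u
    have hu := h u
    generalize t (t u) = b at *
    generalize t u = a at *
    have h' : [u, (finRotate 8 ^ 2) u, (finRotate 8 ^ 2) ((finRotate 8 ^ 2) u),
        (finRotate 8 ^ 2) ((finRotate 8 ^ 2) ((finRotate 8 ^ 2) u)), a, b].Nodup :=
      hu.sublist (by simp)
    clear hu h
    revert u a b
    decide +kernel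
  have h1 := key 0
  have h2 := key (t 0)
  omega

/-- The four permutations compatible with the rotation. -/
def sols : List (Fin 8 → Fin 8) :=
  [![5, 0, 7, 2, 1, 4, 3, 6], ![6, 7, 0, 1, 2, 3, 4, 5], ![7, 0, 1, 2, 3, 4, 5, 6],
    ![7, 6, 1, 0, 3, 2, 5, 4]]

set_option synthInstance.maxSize 100000 in
set_option synthInstance.maxHeartbeats 1000000 in
theorem search : ∀ a : Fin 8, 4 ≤ a - 0 →
    ∀ b : Fin 8, 4 ≤ b - 1 → b ∉ [a] →
    ∀ c : Fin 8, 4 ≤ c - 2 → c ∉ [a, b] →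
    ∀ d : Fin 8, 4 ≤ d - 3 → d ∉ [a, b, c] →
    ∀ e : Fin 8, 4 ≤ e - 4 → e ∉ [a, b, c, d] →
    ∀ f : Fin 8, 4 ≤ f - 5 → f ∉ [a, b, c, d, e] →
    ∀ g : Fin 8, 4 ≤ g - 6 → g ∉ [a, b, c, d, e, f] →
    ∀ h : Fin 8, 4 ≤ h - 7 → h ∉ [a, b, c, d, e, f, g] →
    (∀ u, 4 ≤ ![a, b, c, d, e, f, g, h] (![a, b, c, d, e, f, g, h] u) - u) →
    ![a, b, c, d, e, f, g, h] ∈ sols := by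
  decide +kernel

theorem mem_sols (t : Equiv.Perm (Fin 8)) (h : ∀ u, 4 ≤ t u - u ∧ 4 ≤ t (t u) - u) :
    (t : Fin 8 → Fin 8) ∈ sols := by
  have e : (t : Fin 8 → Fin 8) = ![t 0, t 1, t 2, t 3, t 4, t 5, t 6, t 7] := by
    ext u; fin_cases u <;> rfl
  rw [e]
  refine search _ (h 0).1 _ (h 1).1 ?_ _ (h 2).1 ?_ _ (h 3).1 ?_ _ (h 4).1 ?_ _ (h 5).1 ?_
    _ (h 6).1 ?_ _ (h 7).1 ?_ ?_
  on_goal 8 => rw [← e]; exact fun u => (h u).2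
  all_goals simp [t.injective.eq_iff]

theorem rot_case (t r : Equiv.Perm (Fin 8)) (h : RowsOk (finRotate 8) t r) : False := by
  have aux : ∀ u a : Fin 8, [u, finRotate 8 u, finRotate 8 (finRotate 8 u),
        finRotate 8 (finRotate 8 (finRotate 8 u)), a].Nodup → 4 ≤ a - u := by
    decide +kernel
  have ht := mem_sols t fun u =>
    ⟨aux u _ ((h u).sublist (by simp)), aux u _ ((h u).sublist (by simp))⟩
  have hr := mem_sols r fun u =>
    ⟨aux u _ ((h u).sublist (by simp)), aux u _ ((h u).sublist (by simp))⟩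
  have hne : ∀ u, [t u, t (t u), r u, r (r u)].Nodup := fun u => (h u).of_append_right (l₁ := [_, _, _, _])
  have fin : (sols.all fun x => sols.all fun y =>
      decide (¬ ∀ u, [x u, x (x u), y u, y (y u)].Nodup)) = true := by
    decide +kernel
  have h1 := List.all_eq_true.1 (List.all_eq_true.1 fin _ ht) _ hr
  exact of_decide_eq_true h1 hne

/-- **The `d = 3` lower bound is not attainable for `n = 8`.** There are no
permutations `σ₁, σ₂, σ₃` of `Fin 8` with
`P_{σ₁} + P_{σ₁²} + P_{σ₁³} + P_{σ₂} + P_{σ₂²} + P_{σ₃} + P_{σ₃²} = J − I`. -/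
theorem no_decomposition_n8_d3 :
    ¬ ∃ σ₁ σ₂ σ₃ : Equiv.Perm (Fin 8),
      permMatrix σ₁ + permMatrix (σ₁ ^ 2) + permMatrix (σ₁ ^ 3) +
        permMatrix σ₂ + permMatrix (σ₂ ^ 2) +
        permMatrix σ₃ + permMatrix (σ₃ ^ 2) = allToAll 8 := by
  rintro ⟨s, t, r, h⟩
  have hr := rowsOk_of_eq s t r h
  have hs : ∀ u, s u ≠ u ∧ s (s u) ≠ u ∧ s (s (s u)) ≠ u := by
    intro u
    have h' : [u, s u, s (s u), s (s (s u))].Nodup := (hr u).sublist (by simp)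
    simp only [List.nodup_cons, List.mem_cons, not_or] at h'
    exact ⟨Ne.symm h'.1.1, Ne.symm h'.1.2.1, Ne.symm h'.1.2.2.1⟩
  rcases cycleType_cases s hs with hc | hc
  · obtain ⟨g, hg⟩ := isConj_iff.1 (Equiv.Perm.isConj_of_cycleType_eq (hc.trans cycleType_rot.symm))
    have := rowsOk_conj g s t r hr
    rw [hg] at this
    exact rot_case _ _ this
  · obtain ⟨g, hg⟩ := isConj_iff.1
      (Equiv.Perm.isConj_of_cycleType_eq (hc.trans cycleType_rot_sq.symm))
    have := rowsOk_conj g s t r hr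
    rw [hg] at this
    exact even_case _ _ this
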